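/- Let n ≥ 3 and let M, A, F, H be positive constants. There exists a constant C > 0, depending only on n, M, A, F and H, such that the following holds. Let h, a, f be continuous real functions on the closed ball of radius 2 in ℝⁿ with f ≥ 0 and a ≥ 0 on B₀(2) and with sup_{B₀(2)}|h| ≤ H, sup_{B₀(2)}|a| ≤ A, sup_{B₀(2)}|f| ≤ F, and let u be a positive C² function on B₀(2) with u ≤ M satisfying −Δu + h u = f u^{2*−1} + a u^{−(2*+1)} pointwise on B₀(2). Then for every real γ ≥ 2* + 3 and all 0 < r < R ≤ 2, setting χ = n/(n−2), the reverse-Hölder Moser iteration inequality holds: (∫_{B₀(r)} u^{χγ} dx)^{1/(χγ)} ≤ C^{1/γ} (γ/(R−r)²)^{1/γ} (∫_{B₀(R)} u^{γ} dx)^{(γ−2*−2)/γ²}. -/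

import Mathlib

open MeasureTheory Metric Real

noncomputable section

/-- Euclidean space ℝⁿ. -/
abbrev E (n : ℕ) := EuclideanSpace ℝ (Fin n)

/-- Partial derivative in the `i`-th coordinate direction. -/
noncomputable def pder {n : ℕ} (i : Fin n) (u : E n → ℝ) (x : E n) : ℝ :=
  fderiv ℝ u x (EuclideanSpace.single i 1)

/-- The Euclidean Laplacian `Δu = ∑ᵢ ∂²u/∂xᵢ²`. -/
noncomputable def lap {n : ℕ} (u : E n → ℝ) (x : E n) : ℝ :=
  ∑ i, pder i (pder i u) x

/-- The critical Sobolev exponent `2* = 2n/(n-2)`. -/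
noncomputable def twoStar (n : ℕ) : ℝ := 2 * n / ((n : ℝ) - 2)

lemma continuous_pder {n : ℕ} {v : E n → ℝ} (hv : ContDiff ℝ 1 v) (i : Fin n) :
    Continuous (pder i v) :=
  (hv.continuous_fderiv one_ne_zero).clm_apply
    (continuous_const (y := EuclideanSpace.single i (1 : ℝ)))

lemma hasCompactSupport_pder {n : ℕ} {v : E n → ℝ} (hv : HasCompactSupport v) (i : Fin n) :
    HasCompactSupport (pder i v) :=
  hv.fderiv_apply (𝕜 := ℝ) _

lemma integrable_pder {n : ℕ} {v : E n → ℝ} (hv : ContDiff ℝ 1 v) (hc : HasCompactSupport v)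
    (i : Fin n) : Integrable (pder i v) :=
  (continuous_pder hv i).integrable_of_hasCompactSupport (hasCompactSupport_pder hc i)

lemma integrable_pder_sq {n : ℕ} {v : E n → ℝ} (hv : ContDiff ℝ 1 v) (hc : HasCompactSupport v)
    (i : Fin n) : Integrable (fun x => pder i v x ^ 2) := by
  have h2 : HasCompactSupport (fun x => pder i v x ^ 2) :=
    (hasCompactSupport_pder hc i).comp_left (g := fun t : ℝ => t ^ 2) (by simp)
  exact ((continuous_pder hv i).pow 2).integrable_of_hasCompactSupport h2

lemma integral_pder_eq_zero {n : ℕ} {v : E n → ℝ} (hv : ContDiff ℝ 1 v)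
    (hc : HasCompactSupport v) (i : Fin n) : ∫ x, pder i v x = 0 := by
  have hi := integrable_pder hv hc i
  have h := integral_mul_fderiv_eq_neg_fderiv_mul_of_integrable (μ := (volume : Measure (E n)))
    (f := fun _ => (1 : ℝ)) (g := v) (v := EuclideanSpace.single i 1) (by simp)
    (by simpa using! hi) (by simpa using hv.continuous.integrable_of_hasCompactSupport hc)
    (fun x _ => differentiableAt_const _) (fun x _ => hv.differentiable one_ne_zero x)
  simpa [pder] using h

/-- The squared operator norm of the derivative is at most the sum of the squares of the partial
derivatives. -/
lemma norm_fderiv_sq_le {n : ℕ} (v : E n → ℝ) (x : E n) :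
    ‖fderiv ℝ v x‖ ^ 2 ≤ ∑ i, pder i v x ^ 2 := by
  have key : ‖fderiv ℝ v x‖ ≤ √(∑ i, pder i v x ^ 2) := by
    refine ContinuousLinearMap.opNorm_le_bound _ (sqrt_nonneg _) fun y => ?_
    have hy : y = ∑ i, y i • EuclideanSpace.single i (1 : ℝ) := by
      ext j
      simp [Pi.single_apply]
    have h1 : fderiv ℝ v x y = ∑ i, pder i v x * y i := by
      conv_lhs => rw [hy]
      simp [pder, mul_comm]
    rw [h1, EuclideanSpace.norm_eq y, ← sqrt_mul (Finset.sum_nonneg fun i _ => sq_nonneg _),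
      Real.norm_eq_abs]
    refine abs_le_sqrt ?_
    simpa using Finset.sum_mul_sq_le_sq_mul_sq Finset.univ (fun i => pder i v x) (fun i => y i)
  calc ‖fderiv ℝ v x‖ ^ 2 ≤ √(∑ i, pder i v x ^ 2) ^ 2 := by gcongr
    _ = _ := sq_sqrt (Finset.sum_nonneg fun i _ => sq_nonneg _)

/-- The Sobolev inequality for compactly supported `C¹` functions on ℝⁿ, `n ≥ 3`. -/
lemma exists_sobolev_const (n : ℕ) (hn : 3 ≤ n) :
    ∃ S : ℝ, 0 < S ∧ ∀ v : E n → ℝ, ContDiff ℝ 1 v → HasCompactSupport v →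
      (∫ x, |v x| ^ twoStar n) ^ (2 / twoStar n) ≤ S * ∫ x, ∑ i, pder i v x ^ 2 := by
  have hn' : (3 : ℝ) ≤ n := by exact_mod_cast hn
  have hN : (0 : ℝ) < (n : ℝ) - 2 := by linarith
  have hs : 0 < twoStar n := by unfold twoStar; positivity
  set K := eLpNormLESNormFDerivOfEqInnerConst (volume : Measure (E n)) ((2 : NNReal) : ℝ) with hK
  refine ⟨(K : ℝ) ^ 2 + 1, by positivity, fun v hv hc => ?_⟩
  have hvm : MemLp v (twoStar n).toNNReal := hv.continuous.memLp_of_hasCompactSupport hc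
  have hdc : Continuous (fderiv ℝ v) := hv.continuous_fderiv one_ne_zero
  have hds : HasCompactSupport (fderiv ℝ v) := hc.fderiv (𝕜 := ℝ)
  have hdm : MemLp (fderiv ℝ v) ((2 : NNReal) : ENNReal) :=
    hdc.memLp_of_hasCompactSupport hds
  have h := eLpNorm_le_eLpNorm_fderiv_of_eq_inner (volume : Measure (E n)) hv hc
    (p := 2) (p' := (twoStar n).toNNReal) (by norm_num) (by simp; omega)
    (by
      rw [coe_toNNReal _ hs.le]
      simp only [finrank_euclideanSpace, Fintype.card_fin, twoStar]
      push_cast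
      field_simp)
  rw [hvm.eLpNorm_eq_integral_rpow_norm (by simpa using hs) (by simp),
    hdm.eLpNorm_eq_integral_rpow_norm (by simp) (by simp), ← hK] at h
  simp only [ENNReal.coe_toReal, coe_toNNReal _ hs.le, Real.norm_eq_abs] at h
  rw [← ENNReal.ofReal_coe_nnreal, ← ENNReal.ofReal_mul (by positivity),
    ENNReal.ofReal_le_ofReal_iff (by positivity)] at h
  have hI : 0 ≤ ∫ x, |v x| ^ twoStar n := integral_nonneg fun x => by positivity
  have hD : 0 ≤ ∫ x, ‖fderiv ℝ v x‖ ^ 2 := integral_nonneg fun x => by positivity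
  have hDle : ∫ x, ‖fderiv ℝ v x‖ ^ 2 ≤ ∫ x, ∑ i, pder i v x ^ 2 :=
    integral_mono_of_nonneg (Filter.Eventually.of_forall fun x => by positivity)
      (integrable_finsetSum _ fun i _ => integrable_pder_sq hv hc i)
      (Filter.Eventually.of_forall fun x => norm_fderiv_sq_le v x)
  have h2 := pow_le_pow_left₀ (by positivity) h 2
  have e1 : ((∫ x, |v x| ^ twoStar n) ^ (twoStar n)⁻¹) ^ 2
      = (∫ x, |v x| ^ twoStar n) ^ (2 / twoStar n) := by
    rw [← rpow_natCast, ← rpow_mul hI]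
    congr 1
    push_cast
    ring
  have e2 : ((K : ℝ) * (∫ x, ‖fderiv ℝ v x‖ ^ ((2 : NNReal) : ℝ)) ^ ((2 : NNReal) : ℝ)⁻¹) ^ 2
      = (K : ℝ) ^ 2 * ∫ x, ‖fderiv ℝ v x‖ ^ 2 := by
    rw [mul_pow]
    congr 1
    simp only [NNReal.coe_ofNat, rpow_ofNat]
    rw [← rpow_natCast, ← rpow_mul hD]
    norm_num
  rw [e1, e2] at h2
  refine h2.trans ?_
  gcongr
  linarith

/-- Smooth radial cutoff functions with the natural gradient bound. -/
lemma exists_cutoff (n : ℕ) :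
    ∃ K : ℝ, 0 < K ∧ ∀ r ρ : ℝ, 0 < r → r < ρ → ∃ η : E n → ℝ, ContDiff ℝ 1 η ∧
      (∀ x, 0 ≤ η x) ∧ (∀ x, η x ≤ 1) ∧ (∀ x ∈ ball (0 : E n) r, η x = 1) ∧
      tsupport η ⊆ closedBall 0 ρ ∧ (∀ x, ∑ i, pder i η x ^ 2 ≤ K / (ρ - r) ^ 2) := by
  have hT : ContDiff ℝ 1 smoothTransition := smoothTransition.contDiff (n := 1)
  have hTd := hT.continuous_deriv le_rfl
  obtain ⟨B, hB⟩ := isCompact_Icc.exists_bound_of_continuousOn (s := Set.Icc (0 : ℝ) 1)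
    hTd.continuousOn
  have hB' : ∀ t, |deriv smoothTransition t| ≤ |B| := by
    intro t
    by_cases ht : t ∈ Set.Icc (0 : ℝ) 1
    · exact (hB t ht).trans (le_abs_self B)
    · have h0 : deriv smoothTransition t = 0 := by
        rw [Set.mem_Icc, not_and_or, not_le, not_le] at ht
        rcases ht with ht | ht
        · have : smoothTransition =ᶠ[nhds t] fun _ => 0 := by
            filter_upwards [Iio_mem_nhds ht] with s hs
            exact smoothTransition.zero_of_nonpos (le_of_lt hs)
          rw [this.deriv_eq]; simp
        · have : smoothTransition =ᶠ[nhds t] fun _ => 1 := by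
            filter_upwards [Ioi_mem_nhds ht] with s hs
            exact smoothTransition.one_of_one_le (le_of_lt hs)
          rw [this.deriv_eq]; simp
      simp [h0]
  refine ⟨4 * B ^ 2 + 1, by positivity, fun r ρ hr hrρ => ?_⟩
  have hρ : 0 < ρ := hr.trans hrρ
  have hd : 0 < ρ ^ 2 - r ^ 2 := by nlinarith
  set g : E n → ℝ := fun x => (ρ ^ 2 - ‖x‖ ^ 2) / (ρ ^ 2 - r ^ 2) with hg
  have hgc : ContDiff ℝ 1 g := (contDiff_const.sub (contDiff_norm_sq ℝ)).div_const _
  have hη0 : ∀ x, ρ ≤ ‖x‖ → g x ≤ 0 := fun x hx =>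
    div_nonpos_of_nonpos_of_nonneg (by nlinarith) hd.le
  have hsupp : tsupport (fun x => smoothTransition (g x)) ⊆ closedBall (0 : E n) ρ := by
    refine closure_minimal (fun x hx => ?_) isClosed_closedBall
    rw [mem_closedBall_zero_iff]
    by_contra hcon
    exact hx (smoothTransition.zero_of_nonpos (hη0 x (not_le.1 hcon).le))
  refine ⟨fun x => smoothTransition (g x), hT.comp hgc, fun x => smoothTransition.nonneg _,
    fun x => smoothTransition.le_one _, fun x hx => ?_, hsupp, fun x => ?_⟩
  · refine smoothTransition.one_of_one_le ((one_le_div hd).2 ?_)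
    rw [mem_ball_zero_iff] at hx
    nlinarith [norm_nonneg x]
  · by_cases hx : ‖x‖ ≤ ρ
    · have hpd : ∀ i, pder i (fun x => smoothTransition (g x)) x
          = deriv smoothTransition (g x) * (-(2 * x i) / (ρ ^ 2 - r ^ 2)) := by
        intro i
        have h1 : HasFDerivAt (fun x : E n => ‖x‖ ^ 2) (2 • innerSL ℝ x) x :=
          (hasStrictFDerivAt_norm_sq x).hasFDerivAt
        have h2 : HasFDerivAt g ((ρ ^ 2 - r ^ 2)⁻¹ • (-(2 • innerSL ℝ x) : E n →L[ℝ] ℝ)) x := by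
          have := (h1.const_sub (ρ ^ 2)).const_smul ((ρ ^ 2 - r ^ 2)⁻¹)
          refine this.congr_of_eventuallyEq (Filter.Eventually.of_forall fun y => ?_)
          simp [hg, div_eq_inv_mul]
        have h3 := ((hT.differentiable one_ne_zero (g x)).hasDerivAt).comp_hasFDerivAt x h2
        have h4 : fderiv ℝ (fun x => smoothTransition (g x)) x = _ := h3.fderiv
        rw [pder, h4]
        simp [EuclideanSpace.inner_single_right]
        ring
      have hsum : ∑ i, pder i (fun x => smoothTransition (g x)) x ^ 2
          = deriv smoothTransition (g x) ^ 2 * (4 * ‖x‖ ^ 2 / (ρ ^ 2 - r ^ 2) ^ 2) := by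
        rw [EuclideanSpace.norm_sq_eq, Finset.mul_sum, Finset.sum_div, Finset.mul_sum]
        refine Finset.sum_congr rfl fun i _ => ?_
        rw [hpd i, mul_pow, div_pow, Real.norm_eq_abs, sq_abs]
        ring
      rw [hsum]
      have e1 : deriv smoothTransition (g x) ^ 2 ≤ B ^ 2 := sq_le_sq.2 (hB' _)
      have hr' : 0 < ρ - r := by linarith
      have e2 : 4 * ‖x‖ ^ 2 / (ρ ^ 2 - r ^ 2) ^ 2 ≤ 4 / (ρ - r) ^ 2 := by
        rw [div_le_div_iff₀ (by positivity) (by positivity)]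
        have : (ρ ^ 2 - r ^ 2) ^ 2 = (ρ + r) ^ 2 * (ρ - r) ^ 2 := by ring
        rw [this]
        have : ‖x‖ ^ 2 ≤ (ρ + r) ^ 2 := by
          gcongr
          linarith
        nlinarith [sq_nonneg (ρ - r)]
      calc _ ≤ B ^ 2 * (4 / (ρ - r) ^ 2) := by gcongr
        _ = 4 * B ^ 2 / (ρ - r) ^ 2 := by ring
        _ ≤ _ := by gcongr; linarith
    · have hz : ∀ i, pder i (fun x => smoothTransition (g x)) x = 0 := by
        intro i
        have : x ∉ tsupport (fun x => smoothTransition (g x)) := fun h =>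
          hx (mem_closedBall_zero_iff.1 (hsupp h))
        have h0 : fderiv ℝ (fun x => smoothTransition (g x)) x = 0 :=
          Function.notMem_support.1 fun h => this (support_fderiv_subset ℝ h)
        rw [pder, h0]
        rfl
      simp only [hz]
      simp
      positivity

/-- Hölder's inequality on a finite measure space, for two powers of a bounded function. -/
lemma integral_rpow_sub_le {α : Type*} [MeasurableSpace α] {μ : Measure α} [IsFiniteMeasure μ]
    {u : α → ℝ} {M γ q : ℝ} (hu : AEStronglyMeasurable u μ) (h0 : ∀ᵐ x ∂μ, 0 < u x)
    (hM : ∀ᵐ x ∂μ, u x ≤ M) (hq : 0 < q) (hqγ : q < γ) :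
    ∫ x, u x ^ (γ - q) ∂μ
      ≤ max 1 (μ.real Set.univ) * (∫ x, u x ^ γ ∂μ) ^ ((γ - q) / γ) := by
  have hγ : 0 < γ := hq.trans hqγ
  have hs : 0 < γ - q := by linarith
  have hpq : (γ / (γ - q)).HolderConjugate (γ / q) := by
    rw [holderConjugate_iff]
    refine ⟨(one_lt_div hs).2 (by linarith), ?_⟩
    field_simp
    ring
  have hm : MemLp (fun x => u x ^ (γ - q)) (ENNReal.ofReal (γ / (γ - q))) μ := by
    refine MemLp.of_bound (hu.aemeasurable.pow_const _).aestronglyMeasurable (M ^ (γ - q)) ?_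
    filter_upwards [h0, hM] with x hx hxM
    rw [Real.norm_of_nonneg (by positivity)]
    exact rpow_le_rpow hx.le hxM hs.le
  have h := integral_mul_le_Lp_mul_Lq_of_nonneg (μ := μ) hpq
    (f := fun x => u x ^ (γ - q)) (g := fun _ => (1 : ℝ))
    (by filter_upwards [h0] with x hx; exact (rpow_pos_of_pos hx _).le)
    (Filter.Eventually.of_forall fun _ => zero_le_one) hm (memLp_const 1)
  have e : ∫ x, (u x ^ (γ - q)) ^ (γ / (γ - q)) ∂μ = ∫ x, u x ^ γ ∂μ := by
    refine integral_congr_ae ?_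
    filter_upwards [h0] with x hx
    rw [← rpow_mul hx.le]
    congr 1
    field_simp
  have hI : 0 ≤ ∫ x, u x ^ γ ∂μ :=
    integral_nonneg_of_ae (by filter_upwards [h0] with x hx; exact (rpow_pos_of_pos hx _).le)
  rw [e] at h
  simp only [mul_one, one_rpow, integral_const, smul_eq_mul, one_div_div] at h
  refine h.trans ?_
  rw [mul_comm]
  gcongr
  refine (rpow_le_rpow measureReal_nonneg (le_max_right 1 _) (by positivity)).trans ?_
  calc _ ≤ max 1 (μ.real Set.univ) ^ (1 : ℝ) :=
        rpow_le_rpow_of_exponent_le (le_max_left _ _) ((div_le_one hγ).2 hqγ.le)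
    _ = _ := rpow_one _

lemma HasFDerivAt.pder_eq {n : ℕ} {v : E n → ℝ} {L : E n →L[ℝ] ℝ} {x : E n}
    (h : HasFDerivAt v L x) (i : Fin n) : pder i v x = L (EuclideanSpace.single i 1) := by
  rw [pder, h.fderiv]

lemma contDiffAt_pder {n : ℕ} {u : E n → ℝ} {x : E n} (hu : ContDiffAt ℝ 2 u x) (i : Fin n) :
    ContDiffAt ℝ 1 (pder i u) x :=
  (hu.fderiv_right (m := 1) (by norm_num)).clm_apply
    (contDiffAt_const (c := EuclideanSpace.single i (1 : ℝ)))

lemma pder_cutoff_mul_sq_le {n : ℕ} {u η : E n → ℝ} {x : E n} {γ : ℝ}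
    (hu : ContDiffAt ℝ 2 u x) (hη : DifferentiableAt ℝ η x) (hx : 0 < u x) (hγ : 2 ≤ γ)
    (i : Fin n) :
    pder i (fun y => η y * u y ^ (γ / 2)) x ^ 2
      ≤ pder i η x ^ 2 * u x ^ γ
        + γ / 2 * (pder i (fun y => η y ^ 2 * u y ^ (γ - 1) * pder i u y) x
          - η x ^ 2 * u x ^ (γ - 1) * pder i (pder i u) x) := by
  have du := (hu.differentiableAt two_ne_zero).hasFDerivAt
  have dη := hη.hasFDerivAt
  have ddu := ((contDiffAt_pder hu i).differentiableAt one_ne_zero).hasFDerivAt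
  have h1 : pder i (fun y => η y * u y ^ (γ / 2)) x
      = η x * (γ / 2 * u x ^ (γ / 2 - 1) * pder i u x) + u x ^ (γ / 2) * pder i η x :=
    (dη.mul (du.rpow_const (p := γ / 2) (Or.inl hx.ne'))).pder_eq i
  have h2 : pder i (fun y => η y ^ 2 * u y ^ (γ - 1) * pder i u y) x
      = η x ^ 2 * u x ^ (γ - 1) * pder i (pder i u) x
        + pder i u x * (η x ^ 2 * ((γ - 1) * u x ^ (γ - 1 - 1) * pder i u x)
          + u x ^ (γ - 1) * (2 * η x * pder i η x)) := by
    have h : pder i (fun y => η y ^ 2 * u y ^ (γ - 1) * pder i u y) x = _ :=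
      (((dη.pow 2).mul (du.rpow_const (p := γ - 1) (Or.inl hx.ne'))).mul ddu).pder_eq i
    rw [h]
    simp [pder]
    ring
  have e0 : u x ^ (γ / 2) = u x ^ (γ / 2 - 1) * u x := by
    rw [rpow_sub_one hx.ne']; field_simp
  have e2 : u x ^ (γ - 1 - 1) = (u x ^ (γ / 2 - 1)) ^ 2 := by
    rw [← rpow_natCast, ← rpow_mul hx.le]; congr 1; push_cast; ring
  have e1 : u x ^ (γ - 1) = (u x ^ (γ / 2 - 1)) ^ 2 * u x := by
    rw [← rpow_natCast, ← rpow_mul hx.le, ← rpow_add_one hx.ne']; congr 1; push_cast; ring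
  have e3 : u x ^ γ = (u x ^ (γ / 2 - 1)) ^ 2 * u x ^ 2 := by
    rw [← rpow_natCast, ← rpow_mul hx.le, ← rpow_natCast, ← rpow_add hx]
    congr 1; push_cast; ring
  rw [h1, h2, e2, e1, e3, e0]
  set U := u x ^ (γ / 2 - 1)
  have : 0 ≤ (η x * U * pder i u x) ^ 2 * (γ * (γ - 2) / 4) := by
    have : 0 ≤ γ - 2 := by linarith
    positivity
  linarith


lemma contDiff_and_hasCompactSupport_of_support {n : ℕ} {v η : E n → ℝ} {ρ : ℝ}
    (hη : tsupport η ⊆ closedBall 0 ρ) (hz : ∀ x, η x = 0 → v x = 0)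
    (hv : ∀ x ∈ closedBall (0 : E n) ρ, ContDiffAt ℝ 1 v x) :
    ContDiff ℝ 1 v ∧ HasCompactSupport v ∧ tsupport v ⊆ closedBall 0 ρ := by
  have hsub : tsupport v ⊆ closedBall 0 ρ :=
    (closure_mono (Function.support_subset_iff'.2 fun x hx =>
      hz x (Function.notMem_support.1 hx))).trans hη
  have hcd : ContDiff ℝ 1 v := by
    refine contDiff_iff_contDiffAt.2 fun x => ?_
    by_cases hx : x ∈ tsupport v
    · exact hv x (hsub hx)
    · exact contDiffAt_const.congr_of_eventuallyEq (notMem_tsupport_iff_eventuallyEq.1 hx)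
  exact ⟨hcd, (isCompact_closedBall _ _).of_isClosed_subset (isClosed_tsupport _) hsub, hsub⟩

lemma pder_eq_zero_of_notMem_tsupport {n : ℕ} {v : E n → ℝ} {x : E n} (hx : x ∉ tsupport v)
    (i : Fin n) : pder i v x = 0 := by
  have h0 : fderiv ℝ v x = 0 :=
    Function.notMem_support.1 fun h => hx (support_fderiv_subset ℝ h)
  rw [pder, h0]
  rfl

/-- The Caccioppoli inequality: if `-Δu` is bounded above by `T u ^ (1 - q)`, the Dirichlet energy
of `η u ^ (γ / 2)` is controlled by the integral of `u ^ (γ - q)`. -/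
lemma integral_pder_cutoff_mul_sq_le {n : ℕ} {u η : E n → ℝ} {γ q M T G ρ R : ℝ}
    (hu : ContDiffOn ℝ 2 u (ball 0 2)) (hpos : ∀ x ∈ ball (0 : E n) 2, 0 < u x)
    (hM : ∀ x ∈ ball (0 : E n) 2, u x ≤ M)
    (hlap : ∀ x ∈ ball (0 : E n) 2, -lap u x ≤ T * u x ^ (1 - q))
    (hT : 0 ≤ T) (hq : 0 < q) (hγ : 2 ≤ γ) (hqγ : q < γ) (hρR : ρ < R) (hR : R ≤ 2)
    (hη : ContDiff ℝ 1 η) (hη1 : ∀ x, |η x| ≤ 1)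
    (hsupp : tsupport η ⊆ closedBall 0 ρ) (hG : ∀ x, ∑ i, pder i η x ^ 2 ≤ G) :
    ContDiff ℝ 1 (fun y => η y * u y ^ (γ / 2)) ∧
    HasCompactSupport (fun y => η y * u y ^ (γ / 2)) ∧
    ∫ x, ∑ i, pder i (fun y => η y * u y ^ (γ / 2)) x ^ 2
      ≤ (G * M ^ q + γ / 2 * T) * ∫ x in ball (0 : E n) R, u x ^ (γ - q) := by
  have hsub : closedBall (0 : E n) ρ ⊆ ball 0 R := closedBall_subset_ball hρR
  have hsub2 : ball (0 : E n) R ⊆ ball 0 2 := ball_subset_ball hR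
  have hat : ∀ x ∈ ball (0 : E n) 2, ContDiffAt ℝ 2 u x := fun x hx =>
    hu.contDiffAt (isOpen_ball.mem_nhds hx)
  have hat1 : ∀ x ∈ ball (0 : E n) 2, ∀ p : ℝ, ContDiffAt ℝ 1 (fun y => u y ^ p) x :=
    fun x hx p => ((hat x hx).of_le one_le_two).rpow_const_of_ne (hpos x hx).ne'
  obtain ⟨hv, hvc, hvs⟩ := contDiff_and_hasCompactSupport_of_support
    (v := fun y => η y * u y ^ (γ / 2)) hsupp (fun x h0 => by simp [h0])
    (fun x hx => hη.contDiffAt.mul (hat1 x (hsub2 (hsub hx)) _))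
  have hV := fun i => contDiff_and_hasCompactSupport_of_support
    (v := fun y => η y ^ 2 * u y ^ (γ - 1) * pder i u y) hsupp (fun x h0 => by simp [h0])
    (fun x hx => ((hη.contDiffAt.pow 2).mul (hat1 x (hsub2 (hsub hx)) _)).mul
      (contDiffAt_pder (hat x (hsub2 (hsub hx))) i))
  refine ⟨hv, hvc, ?_⟩
  set v : E n → ℝ := fun y => η y * u y ^ (γ / 2) with hvdef
  set V : Fin n → E n → ℝ := fun i y => η y ^ 2 * u y ^ (γ - 1) * pder i u y with hVdef
  have hvi : Integrable (fun x => ∑ i, pder i v x ^ 2) :=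
    integrable_finsetSum _ fun i _ => integrable_pder_sq hv hvc i
  have hVi : Integrable (fun x => ∑ i, pder i (V i) x) :=
    integrable_finsetSum _ fun i _ => integrable_pder (hV i).1 (hV i).2.1 i
  have hV0 : ∫ x, ∑ i, pder i (V i) x = 0 := by
    rw [integral_finsetSum _ fun i _ => integrable_pder (hV i).1 (hV i).2.1 i]
    exact Finset.sum_eq_zero fun i _ => integral_pder_eq_zero (hV i).1 (hV i).2.1 i
  set L := G * M ^ q + γ / 2 * T with hL
  have hpt : ∀ x, ∑ i, pder i v x ^ 2 - γ / 2 * ∑ i, pder i (V i) x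
      ≤ (ball (0 : E n) R).indicator (fun x => L * u x ^ (γ - q)) x := by
    intro x
    by_cases hx : x ∈ ball (0 : E n) R
    · rw [Set.indicator_of_mem hx]
      have hx2 := hsub2 hx
      have hux := hpos x hx2
      have hi := fun i => pder_cutoff_mul_sq_le (hat x hx2) (hη.differentiable one_ne_zero x)
        hux hγ i
      have hsum := Finset.sum_le_sum fun i (_ : i ∈ Finset.univ) => hi i
      rw [Finset.sum_add_distrib, ← Finset.sum_mul, ← Finset.mul_sum, Finset.sum_sub_distrib,
        ← Finset.mul_sum] at hsum
      have e1 : u x ^ γ ≤ M ^ q * u x ^ (γ - q) := by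
        calc u x ^ γ = u x ^ q * u x ^ (γ - q) := by rw [← rpow_add hux]; congr 1; ring
          _ ≤ _ := by
            gcongr
            exact hM x hx2
      have e2 : (∑ i, pder i η x ^ 2) * u x ^ γ ≤ G * (M ^ q * u x ^ (γ - q)) :=
        mul_le_mul (hG x) e1 (by positivity)
          ((Finset.sum_nonneg fun i _ => sq_nonneg _).trans (hG x))
      have e3 : η x ^ 2 * u x ^ (γ - 1) * -lap u x ≤ T * u x ^ (γ - q) := by
        calc η x ^ 2 * u x ^ (γ - 1) * -lap u x
            ≤ η x ^ 2 * u x ^ (γ - 1) * (T * u x ^ (1 - q)) := by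
              gcongr
              exact hlap x hx2
          _ ≤ 1 * u x ^ (γ - 1) * (T * u x ^ (1 - q)) := by
              gcongr
              exact (sq_le_one_iff_abs_le_one _).2 (hη1 x)
          _ = T * (u x ^ (γ - 1) * u x ^ (1 - q)) := by ring
          _ = _ := by rw [← rpow_add hux]; congr 2; ring
      have e4 := mul_le_mul_of_nonneg_left e3 (by linarith : 0 ≤ γ / 2)
      change _ ≤ _ + _ * (_ - _ * lap u x) at hsum
      simp only [hvdef, hVdef, hL]
      linarith
    · rw [Set.indicator_of_notMem hx]
      have hz : ∀ i, pder i v x = 0 := fun i =>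
        pder_eq_zero_of_notMem_tsupport (fun h => hx (hsub (hvs h))) i
      have hz' : ∀ i, pder i (V i) x = 0 := fun i =>
        pder_eq_zero_of_notMem_tsupport (fun h => hx (hsub ((hV i).2.2 h))) i
      simp [hz, hz']
  have hintg : IntegrableOn (fun x => u x ^ (γ - q)) (ball (0 : E n) R) := by
    have hc : ContinuousOn (fun x => u x ^ (γ - q)) (ball (0 : E n) R) :=
      (hu.continuousOn.mono hsub2).rpow_const fun x hx => Or.inl (hpos x (hsub2 hx)).ne'
    refine IntegrableOn.of_bound measure_ball_lt_top
      (hc.aestronglyMeasurable measurableSet_ball) (M ^ (γ - q)) ?_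
    filter_upwards [ae_restrict_mem measurableSet_ball] with x hx
    have hux := hpos x (hsub2 hx)
    rw [Real.norm_of_nonneg (by positivity)]
    exact rpow_le_rpow hux.le (hM x (hsub2 hx)) (by linarith)
  calc ∫ x, ∑ i, pder i v x ^ 2
      = ∫ x, (∑ i, pder i v x ^ 2 - γ / 2 * ∑ i, pder i (V i) x) := by
        rw [integral_sub hvi (hVi.const_mul _), integral_const_mul, hV0]
        ring
    _ ≤ ∫ x, (ball (0 : E n) R).indicator (fun x => L * u x ^ (γ - q)) x :=
        integral_mono (hvi.sub (hVi.const_mul _))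
          ((integrable_indicator_iff measurableSet_ball).2 (hintg.const_mul L)) hpt
    _ = _ := by rw [integral_indicator measurableSet_ball, integral_const_mul]

/-- The right-hand side of the Einstein–Lichnerowicz equation is bounded by a multiple of its
most singular term. -/
lemma neg_lap_le {n : ℕ} {h a f u : E n → ℝ} {x : E n} {M A F H s : ℝ} (hs : 0 < s)
    (hh : |h x| ≤ H) (ha : |a x| ≤ A) (hf : |f x| ≤ F) (hx : 0 < u x) (hM : u x ≤ M)
    (heq : -lap u x + h x * u x = f x * u x ^ (s - 1) + a x * u x ^ (-(s + 1))) :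
    -lap u x ≤ (F * M ^ (2 * s) + A + H * M ^ (s + 2)) * u x ^ (1 - (s + 2)) := by
  have hF : 0 ≤ F := (abs_nonneg _).trans hf
  have hH : 0 ≤ H := (abs_nonneg _).trans hh
  have e1 : u x ^ (s - 1) ≤ M ^ (2 * s) * u x ^ (1 - (s + 2)) := by
    calc u x ^ (s - 1) = u x ^ (2 * s) * u x ^ (1 - (s + 2)) := by
          rw [← rpow_add hx]; congr 1; ring
      _ ≤ _ := by gcongr
  have e2 : u x ≤ M ^ (s + 2) * u x ^ (1 - (s + 2)) := by
    calc u x = u x ^ (s + 2) * u x ^ (1 - (s + 2)) := by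
          rw [← rpow_add hx, add_sub_cancel, rpow_one]
      _ ≤ _ := by gcongr
  have e3 : u x ^ (-(s + 1)) = u x ^ (1 - (s + 2)) := by congr 1; ring
  rw [e3] at heq
  have t1 : f x * u x ^ (s - 1) ≤ F * (M ^ (2 * s) * u x ^ (1 - (s + 2))) :=
    mul_le_mul ((le_abs_self _).trans hf) e1 (by positivity) hF
  have t2 : a x * u x ^ (1 - (s + 2)) ≤ A * u x ^ (1 - (s + 2)) := by
    gcongr
    exact (le_abs_self _).trans ha
  have t3 : -h x * u x ≤ H * (M ^ (s + 2) * u x ^ (1 - (s + 2))) :=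
    mul_le_mul ((neg_le_abs _).trans hh) e2 hx.le hH
  linarith

/-- Reverse-Hölder Moser iteration inequality: with `χ = n/(n−2)`, for every `γ ≥ 2*+3`
and `0 < r < R ≤ 2`,
`‖u‖_{L^{χγ}(B₀(r))} ≤ C^{1/γ} (γ/(R−r)²)^{1/γ} ‖u‖_{L^γ(B₀(R))}^{(γ−2*−2)/γ}`,
where `C` depends only on `n, M, A, F, H`. -/
theorem moser_iteration_einstein_lichnerowicz
    (n : ℕ) (hn : 3 ≤ n) (M A F H : ℝ)
    (hM : 0 < M) (hA : 0 < A) (hF : 0 < F) (hH : 0 < H) :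
    ∃ C : ℝ, 0 < C ∧
      ∀ (h a f u : E n → ℝ),
        ContinuousOn h (closedBall 0 2) →
        ContinuousOn a (closedBall 0 2) →
        ContinuousOn f (closedBall 0 2) →
        (∀ x ∈ closedBall (0 : E n) 2, 0 ≤ f x) →
        (∀ x ∈ closedBall (0 : E n) 2, 0 ≤ a x) →
        (∀ x ∈ closedBall (0 : E n) 2, |h x| ≤ H) →
        (∀ x ∈ closedBall (0 : E n) 2, |a x| ≤ A) →
        (∀ x ∈ closedBall (0 : E n) 2, |f x| ≤ F) →
        ContDiffOn ℝ 2 u (ball 0 2) →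
        (∀ x ∈ ball (0 : E n) 2, 0 < u x) →
        (∀ x ∈ ball (0 : E n) 2, u x ≤ M) →
        (∀ x ∈ ball (0 : E n) 2,
          -lap u x + h x * u x
            = f x * u x ^ (twoStar n - 1) + a x * u x ^ (-(twoStar n + 1))) →
        ∀ γ : ℝ, twoStar n + 3 ≤ γ →
        ∀ r R : ℝ, 0 < r → r < R → R ≤ 2 →
          (∫ x in ball (0 : E n) r, u x ^ (((n : ℝ) / ((n : ℝ) - 2)) * γ))
              ^ (1 / (((n : ℝ) / ((n : ℝ) - 2)) * γ))
            ≤ C ^ (1 / γ) * (γ / (R - r) ^ 2) ^ (1 / γ) *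
              (∫ x in ball (0 : E n) R, u x ^ γ) ^ ((γ - twoStar n - 2) / γ ^ 2) := by
  have hn' : (3 : ℝ) ≤ n := by exact_mod_cast hn
  have hN : (0 : ℝ) < (n : ℝ) - 2 := by linarith
  set s := twoStar n with hs
  have hs0 : 0 < s := by rw [hs, twoStar]; positivity
  set χ := (n : ℝ) / ((n : ℝ) - 2) with hχ
  have hχ0 : 0 < χ := by positivity
  have hsχ : s = 2 * χ := by rw [hs, twoStar, hχ]; ring
  obtain ⟨S, hS, hsob⟩ := exists_sobolev_const n hn
  obtain ⟨K, hK, hcut⟩ := exists_cutoff n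
  set T := F * M ^ (2 * s) + A + H * M ^ (s + 2) with hT
  set W := max 1 (volume.real (ball (0 : E n) 2)) with hW
  have hW0 : 0 < W := lt_max_of_lt_left one_pos
  refine ⟨S * ((4 * K * M ^ (s + 2) + 2 * T) * W), by positivity, ?_⟩
  intro h a f u _ _ _ _ _ hh ha hf hu hpos hM heq γ hγ r R hr hrR hR
  have hγ0 : 0 < γ := by linarith
  have hsub2 : ball (0 : E n) R ⊆ ball 0 2 := ball_subset_ball hR
  have hrρ : r < (r + R) / 2 := by linarith
  obtain ⟨η, hη, hη0, hη1, hηr, hsupp, hG⟩ := hcut r ((r + R) / 2) hr hrρ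
  have hcl : ∀ x ∈ ball (0 : E n) 2, x ∈ closedBall (0 : E n) 2 := fun x hx =>
    ball_subset_closedBall hx
  obtain ⟨hv, hvc, hen⟩ := integral_pder_cutoff_mul_sq_le (γ := γ) (q := s + 2) (R := R)
    hu hpos hM
    (fun x hx => neg_lap_le hs0 (hh x (hcl x hx)) (ha x (hcl x hx)) (hf x (hcl x hx)) (hpos x hx)
      (hM x hx) (heq x hx)) (by positivity) (by positivity) (by linarith) (by linarith)
    (by linarith) hR hη (fun x => abs_le.2 ⟨by linarith [hη0 x], hη1 x⟩) hsupp hG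
  have hsb := hsob _ hv hvc
  have hfin : IsFiniteMeasure (volume.restrict (ball (0 : E n) R)) :=
    isFiniteMeasure_restrict.2 measure_ball_lt_top.ne
  have hmem := ae_restrict_mem (μ := (volume : Measure (E n)))
    (measurableSet_ball (x := 0) (ε := R))
  have hho := integral_rpow_sub_le (μ := volume.restrict (ball (0 : E n) R)) (u := u) (M := M)
    (γ := γ) (q := s + 2)
    ((hu.continuousOn.mono hsub2).aestronglyMeasurable measurableSet_ball)
    (hmem.mono fun x hx => hpos x (hsub2 hx)) (hmem.mono fun x hx => hM x (hsub2 hx))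
    (by positivity) (by linarith)
  set Y := ∫ x in ball (0 : E n) R, u x ^ γ with hY
  have hY0 : 0 ≤ Y := setIntegral_nonneg measurableSet_ball fun x hx =>
    (rpow_pos_of_pos (hpos x (hsub2 hx)) _).le
  set X := ∫ x in ball (0 : E n) r, u x ^ (χ * γ) with hX
  have hr2 : ball (0 : E n) r ⊆ ball 0 2 := ball_subset_ball (by linarith)
  have hX0 : 0 ≤ X := setIntegral_nonneg measurableSet_ball fun x hx =>
    (rpow_pos_of_pos (hpos x (hr2 hx)) _).le
  have hXle : X ≤ ∫ x, |η x * u x ^ (γ / 2)| ^ s := by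
    have hintg : Integrable (fun x => |η x * u x ^ (γ / 2)| ^ s) := by
      refine (hv.continuous.abs.rpow_const fun _ => Or.inr hs0.le).integrable_of_hasCompactSupport
        (hvc.comp_left (g := fun t : ℝ => |t| ^ s) ?_)
      simp [hs0.ne']
    refine le_trans (le_of_eq ?_) (setIntegral_le_integral (s := ball (0 : E n) r) hintg
      (Filter.Eventually.of_forall fun x => by positivity))
    refine setIntegral_congr_fun measurableSet_ball fun x hx => ?_
    have hux := hpos x (hr2 hx)
    simp only [hηr x hx, one_mul]
    rw [abs_of_pos (by positivity), ← rpow_mul hux.le, hsχ]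
    congr 1
    ring
  have hW' : max 1 ((volume.restrict (ball (0 : E n) R)).real Set.univ) ≤ W := by
    rw [measureReal_restrict_apply_univ]
    exact max_le_max_left 1 (measureReal_mono hsub2 measure_ball_lt_top.ne)
  have hRr : 0 < R - r := by linarith
  have hL : K / ((r + R) / 2 - r) ^ 2 * M ^ (s + 2) + γ / 2 * T
      ≤ (4 * K * M ^ (s + 2) + 2 * T) * (γ / (R - r) ^ 2) := by
    have e : K / ((r + R) / 2 - r) ^ 2 = 4 * K / (R - r) ^ 2 := by
      rw [show (r + R) / 2 - r = (R - r) / 2 by ring]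
      field_simp
      norm_num
    have h1 : 1 / 4 ≤ 1 / (R - r) ^ 2 :=
      one_div_le_one_div_of_le (by positivity) (by nlinarith)
    have h2 : 1 / (R - r) ^ 2 ≤ γ / (R - r) ^ 2 := by
      gcongr
      linarith
    have hT0 : 0 < T := by positivity
    calc _ = 4 * K * M ^ (s + 2) * (1 / (R - r) ^ 2) + 2 * T * (γ * (1 / 4)) := by
          rw [e]; ring
      _ ≤ 4 * K * M ^ (s + 2) * (γ / (R - r) ^ 2) + 2 * T * (γ * (1 / (R - r) ^ 2)) := by
          gcongr
      _ = _ := by ring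
  have hfinal : X ^ (1 / χ) ≤ S * ((4 * K * M ^ (s + 2) + 2 * T) * W) * (γ / (R - r) ^ 2)
      * Y ^ ((γ - s - 2) / γ) := by
    calc X ^ (1 / χ) = X ^ (2 / s) := by
          rw [hsχ]; congr 1; field_simp
      _ ≤ (∫ x, |η x * u x ^ (γ / 2)| ^ s) ^ (2 / s) := by gcongr
      _ ≤ _ := hsb
      _ ≤ S * (((4 * K * M ^ (s + 2) + 2 * T) * (γ / (R - r) ^ 2))
            * (W * Y ^ ((γ - (s + 2)) / γ))) := by
          gcongr
          refine hen.trans ?_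
          refine mul_le_mul hL (hho.trans ?_) ?_ (by positivity)
          · gcongr
          · exact setIntegral_nonneg measurableSet_ball fun x hx =>
              (rpow_pos_of_pos (hpos x (hsub2 hx)) _).le
      _ = _ := by rw [sub_sub]; ring
  have hlast := rpow_le_rpow (by positivity) hfinal (by positivity : 0 ≤ 1 / γ)
  rw [mul_rpow (by positivity) (by positivity), mul_rpow (by positivity) (by positivity),
    ← rpow_mul hX0, ← rpow_mul hY0] at hlast
  convert hlast using 2
  · field_simp
  · congr 1
    field_simp

end
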